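/- arXiv:2509.08543 — 2 statements merged into one kernel-verified Lean document; each statement's English description precedes it below -/
import Mathlib

section
/- Let Ω ⊆ ℝ^N be open, let w : Ω → ℝ be a nonnegative C¹ function with |∇w(x)| ≤ L for all x ∈ Ω, and let v ∈ C_c^∞(Ω). Then the identity ∫_Ω w²|∇v|² = -2∫_Ω w·v·(∇w·∇v) - ∫_Ω w²·v·Δv holds, and consequently ‖w∇v‖_{L²(Ω)} ≤ 2L‖v‖_{L²(Ω)} + ‖v‖_{L²(Ω)}^{1/2}·‖w²Δv‖_{L²(Ω)}^{1/2}. -/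
open RealInnerProductSpace

/-- Second partial derivative `∂²v/∂x_i∂x_j` on `ℝ^N`. -/
noncomputable def secondPartial (N : ℕ) (v : EuclideanSpace ℝ (Fin N) → ℝ)
    (i j : Fin N) (x : EuclideanSpace ℝ (Fin N)) : ℝ :=
  fderiv ℝ (fun y => fderiv ℝ v y (EuclideanSpace.single i 1)) x (EuclideanSpace.single j 1)

open MeasureTheory

lemma aux_int {N : ℕ} {Ω K : Set (EuclideanSpace ℝ (Fin N))} (hK : IsCompact K) (hKΩ : K ⊆ Ω)
    {h : EuclideanSpace ℝ (Fin N) → ℝ} (hc : ContinuousOn h Ω) (h0 : ∀ x, x ∉ K → h x = 0) :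
    Integrable h := by
  have h1 : IntegrableOn h K := (hc.mono hKΩ).integrableOn_compact hK
  refine (integrableOn_iff_integrable_of_support_subset ?_).1 h1
  intro x hx
  by_contra hxK
  exact hx (h0 x hxK)

lemma aux_cs {α : Type*} [MeasurableSpace α] {μ : Measure α} {f g : α → ℝ}
    (hf : Integrable (fun x => f x ^ 2) μ) (hg : Integrable (fun x => g x ^ 2) μ)
    (hfg : Integrable (fun x => f x * g x) μ) :
    |∫ x, f x * g x ∂μ| ≤ √(∫ x, f x ^ 2 ∂μ) * √(∫ x, g x ^ 2 ∂μ) := by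
  have hF : 0 ≤ ∫ x, f x ^ 2 ∂μ := integral_nonneg fun x => sq_nonneg _
  have key : ∀ t : ℝ, 0 ≤ (∫ x, f x ^ 2 ∂μ) * (t * t) + (2 * ∫ x, f x * g x ∂μ) * t
      + ∫ x, g x ^ 2 ∂μ := by
    intro t
    have h1 : 0 ≤ ∫ x, (f x * t + g x) ^ 2 ∂μ := integral_nonneg fun x => sq_nonneg _
    have h2 : (∫ x, (f x * t + g x) ^ 2 ∂μ) =
        ∫ x, ((t * t) * f x ^ 2 + (2 * t) * (f x * g x)) + g x ^ 2 ∂μ := by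
      congr 1; ext x; ring
    have hab : Integrable (fun x => (t * t) * f x ^ 2 + (2 * t) * (f x * g x)) μ :=
      (hf.const_mul _).add (hfg.const_mul _)
    rw [h2, integral_add hab hg,
      integral_add (hf.const_mul _) (hfg.const_mul _), integral_const_mul,
      integral_const_mul] at h1
    linarith
  have hd := discrim_le_zero key
  unfold discrim at hd
  rw [← Real.sqrt_mul hF]
  apply Real.abs_le_sqrt
  nlinarith

lemma aux_quad {a b c L : ℝ} (hb : 0 ≤ b) (hc : 0 ≤ c) (hL : 0 ≤ L)
    (h : a ^ 2 ≤ 2 * L * (b * a) + b * c) : a ≤ 2 * L * b + √b * √c := by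
  by_contra! hlt
  have hs : 0 ≤ √b * √c := by positivity
  have hss : (√b * √c) * (√b * √c) = b * c := by
    rw [mul_mul_mul_comm, Real.mul_self_sqrt hb, Real.mul_self_sqrt hc]
  have hLb : 0 ≤ 2 * L * b := by positivity
  have h1 : √b * √c < a := by linarith
  have h2 : √b * √c < a - 2 * L * b := by linarith
  have := mul_lt_mul'' h1 h2 hs hs
  nlinarith

lemma grad_coord {N : ℕ} (f : EuclideanSpace ℝ (Fin N) → ℝ) (x : EuclideanSpace ℝ (Fin N))
    (i : Fin N) : gradient f x i = fderiv ℝ f x (EuclideanSpace.single i 1) := by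
  have h := InnerProductSpace.toDual_symm_apply (𝕜 := ℝ) (x := EuclideanSpace.single i (1 : ℝ))
    (y := fderiv ℝ f x)
  rw [← h, EuclideanSpace.inner_single_right]
  simp [gradient]

lemma aux_div {N : ℕ} {Ω : Set (EuclideanSpace ℝ (Fin N))} (hΩ : IsOpen Ω)
    {w : EuclideanSpace ℝ (Fin N) → ℝ} (hw : ContDiffOn ℝ 1 w Ω)
    {v : EuclideanSpace ℝ (Fin N) → ℝ} (hv : ContDiff ℝ (⊤ : ℕ∞) v)
    (hc : HasCompactSupport v) (hs : tsupport v ⊆ Ω) (i : Fin N) :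
    ∫ x in Ω, (2 * (w x * v x * (gradient w x i * gradient v x i))
      + w x ^ 2 * (gradient v x i) ^ 2 + w x ^ 2 * v x * secondPartial N v i i x) = 0 := by
  set e : EuclideanSpace ℝ (Fin N) := EuclideanSpace.single i 1 with he
  set p : EuclideanSpace ℝ (Fin N) → ℝ := fun y => fderiv ℝ v y e with hp
  have hpC : ContDiff ℝ 1 p := by
    have : ContDiff ℝ 1 (fderiv ℝ v) := hv.fderiv_right (by norm_cast)
    exact this.clm_apply contDiff_const
  have hv1 : ContDiff ℝ 1 v := hv.of_le (by norm_cast)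
  set F : EuclideanSpace ℝ (Fin N) → ℝ := fun y => w y ^ 2 * (v y * p y) with hF
  have hFC : ContDiffOn ℝ 1 F Ω := (hw.pow 2).mul (hv1.mul hpC).contDiffOn
  have hsupp : tsupport F ⊆ tsupport v := by
    apply closure_mono
    intro x hx hx0
    apply hx
    simp [hF, hx0]
  have hF0 : ∀ x, x ∉ tsupport v → F x = 0 := fun x hx =>
    image_eq_zero_of_notMem_tsupport fun h => hx (hsupp h)
  have hF0' : ∀ x, x ∉ tsupport v → fderiv ℝ F x e = 0 := by
    intro x hx
    have : fderiv ℝ F x = 0 := by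
      by_contra h
      exact hx (hsupp (support_fderiv_subset ℝ h))
    simp [this]
  have hFd : Differentiable ℝ F := by
    intro x
    by_cases hx : x ∈ Ω
    · exact (hFC.differentiableOn one_ne_zero).differentiableAt (hΩ.mem_nhds hx)
    · have hx' : x ∉ tsupport F := fun h => hx (hs (hsupp h))
      have := notMem_tsupport_iff_eventuallyEq.1 hx'
      exact (differentiableAt_const (0 : ℝ)).congr_of_eventuallyEq this
  have hI : Integrable F := aux_int hc hs hFC.continuousOn hF0
  have hI' : Integrable (fun x => fderiv ℝ F x e) := by
    refine aux_int hc hs ?_ hF0'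
    exact (hFC.continuousOn_fderiv_of_isOpen hΩ le_rfl).clm_apply continuousOn_const
  have hzero : ∫ x, fderiv ℝ F x e = 0 := by
    have := integral_mul_fderiv_eq_neg_fderiv_mul_of_integrable (μ := volume) (𝕜 := ℝ)
      (f := F) (g := fun _ => (1 : ℝ)) (v := e)
      (by simpa using hI') (by simp) (by simpa using hI) (fun x _ => hFd x) (fun x _ => by fun_prop)
    simpa using this
  have hset : ∫ x in Ω, fderiv ℝ F x e = 0 := by
    rw [setIntegral_eq_integral_of_forall_compl_eq_zero, hzero]
    intro x hx
    exact hF0' x fun h => hx (hs h)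
  rw [← hset]
  refine setIntegral_congr_fun hΩ.measurableSet ?_
  intro x hx
  have hwd : DifferentiableAt ℝ w x :=
    (hw.differentiableOn one_ne_zero).differentiableAt (hΩ.mem_nhds hx)
  have hvd : HasFDerivAt v (fderiv ℝ v x) x := (hv1.differentiable one_ne_zero x).hasFDerivAt
  have hpd : HasFDerivAt p (fderiv ℝ p x) x := (hpC.differentiable one_ne_zero x).hasFDerivAt
  have h := (hwd.hasFDerivAt.pow 2).mul (hvd.mul hpd)
  have h' : fderiv ℝ F x = _ := h.fderiv
  have e1 : secondPartial N v i i x = fderiv ℝ p x e := rfl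
  have e2 : p x = fderiv ℝ v x e := rfl
  simp only [h', grad_coord, e1, ← he]
  simp [e2]
  ring

/-- Weighted first-order elliptic estimate: if `w ≥ 0` is `C¹` on the open set `Ω`
with `|∇w| ≤ L`, then for `v ∈ C_c^∞(Ω)`,
`∫ w²|∇v|² = -2∫ w v (∇w·∇v) - ∫ w² v Δv` and consequently
`‖w∇v‖_{L²} ≤ 2L‖v‖_{L²} + ‖v‖_{L²}^{1/2} ‖w²Δv‖_{L²}^{1/2}`. -/
theorem stmt11 (N : ℕ) (Ω : Set (EuclideanSpace ℝ (Fin N))) (hΩ : IsOpen Ω)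
    (w : EuclideanSpace ℝ (Fin N) → ℝ) (L : ℝ)
    (hw : ContDiffOn ℝ 1 w Ω) (hw0 : ∀ x ∈ Ω, 0 ≤ w x)
    (hwL : ∀ x ∈ Ω, ‖gradient w x‖ ≤ L)
    (v : EuclideanSpace ℝ (Fin N) → ℝ) (hv : ContDiff ℝ (⊤ : ℕ∞) v)
    (hc : HasCompactSupport v) (hs : tsupport v ⊆ Ω) :
    ((∫ x in Ω, (w x) ^ 2 * ‖gradient v x‖ ^ 2) =
        -2 * (∫ x in Ω, w x * v x * ⟪gradient w x, gradient v x⟫) -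
          ∫ x in Ω, (w x) ^ 2 * v x * (∑ i, secondPartial N v i i x)) ∧
      Real.sqrt (∫ x in Ω, (w x) ^ 2 * ‖gradient v x‖ ^ 2) ≤
        2 * L * Real.sqrt (∫ x in Ω, (v x) ^ 2) +
          Real.sqrt (Real.sqrt (∫ x in Ω, (v x) ^ 2)) *
            Real.sqrt (Real.sqrt
              (∫ x in Ω, ((w x) ^ 2 * (∑ i, secondPartial N v i i x)) ^ 2)) := by
  have hK : IsCompact (tsupport v) := hc
  have hv1 : ContDiff ℝ 1 v := hv.of_le (by norm_cast)
  have hwc : ContinuousOn w Ω := hw.continuousOn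
  have hgw : ∀ i, ContinuousOn (fun x => gradient w x i) Ω := by
    intro i
    simp only [grad_coord]
    exact (hw.continuousOn_fderiv_of_isOpen hΩ le_rfl).clm_apply continuousOn_const
  have hgv : ∀ i, ContinuousOn (fun x => gradient v x i) Ω := by
    intro i
    simp only [grad_coord]
    exact ((hv1.continuous_fderiv one_ne_zero).clm_apply continuous_const).continuousOn
  have hsp : ∀ i, ContinuousOn (fun x => secondPartial N v i i x) Ω := by
    intro i
    have h1 : ContDiff ℝ 1 (fderiv ℝ v) := hv.fderiv_right (by norm_cast)
    have h2 : ContDiff ℝ 1 (fun y => fderiv ℝ v y (EuclideanSpace.single i 1)) :=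
      h1.clm_apply contDiff_const
    exact ((h2.continuous_fderiv one_ne_zero).clm_apply continuous_const).continuousOn
  have hvc : ContinuousOn v Ω := hv.continuous.continuousOn
  have hlap : ContinuousOn (fun x => ∑ i, secondPartial N v i i x) Ω :=
    continuousOn_finsetSum _ fun i _ => hsp i
  have hv0 : ∀ x, x ∉ tsupport v → v x = 0 := fun x hx => image_eq_zero_of_notMem_tsupport hx
  have hg0 : ∀ x, x ∉ tsupport v → gradient v x = 0 := by
    intro x hx
    have : fderiv ℝ v x = 0 := by
      by_contra h
      exact hx (support_fderiv_subset ℝ h)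
    simp [gradient, this]
  have hs0 : ∀ i x, x ∉ tsupport v → secondPartial N v i i x = 0 := by
    intro i x hx
    have h1 : (fun y => fderiv ℝ v y (EuclideanSpace.single i 1)) =ᶠ[nhds x] fun _ => (0 : ℝ) := by
      filter_upwards [(isClosed_tsupport v).isOpen_compl.mem_nhds hx] with y hy
      rw [← grad_coord, hg0 y hy]; rfl
    simp [secondPartial, h1.fderiv_eq]
  have hin : ∀ x, (⟪gradient w x, gradient v x⟫ : ℝ) = ∑ i, gradient w x i * gradient v x i := by
    intro x
    rw [PiLp.inner_apply]
    simp [mul_comm]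
  have hnm : ∀ x, ‖gradient v x‖ ^ 2 = ∑ i, (gradient v x i) ^ 2 := by
    intro x
    simp [EuclideanSpace.norm_sq_eq]
  have hinc : ContinuousOn (fun x => (⟪gradient w x, gradient v x⟫ : ℝ)) Ω := by
    simp only [hin]
    exact continuousOn_finsetSum _ fun i _ => (hgw i).mul (hgv i)
  have hnmc : ContinuousOn (fun x => ‖gradient v x‖ ^ 2) Ω := by
    simp only [hnm]
    exact continuousOn_finsetSum _ fun i _ => (hgv i).pow 2
  have hnmc1 : ContinuousOn (fun x => ‖gradient v x‖) Ω := by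
    have := hnmc.sqrt
    simpa [Real.sqrt_sq] using this
  have iA : Integrable (fun x => w x ^ 2 * ‖gradient v x‖ ^ 2) :=
    aux_int hK hs ((hwc.pow 2).mul hnmc) fun x hx => by simp [hg0 x hx]
  have iB : Integrable (fun x => w x * v x * (⟪gradient w x, gradient v x⟫ : ℝ)) :=
    aux_int hK hs ((hwc.mul hvc).mul hinc) fun x hx => by simp [hv0 x hx]
  have iC : Integrable (fun x => w x ^ 2 * v x * (∑ i, secondPartial N v i i x)) :=
    aux_int hK hs (((hwc.pow 2).mul hvc).mul hlap) fun x hx => by simp [hv0 x hx]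
  have iV : Integrable (fun x => v x ^ 2) :=
    aux_int hK hs (hvc.pow 2) fun x hx => by simp [hv0 x hx]
  have iD : Integrable (fun x => (w x ^ 2 * (∑ i, secondPartial N v i i x)) ^ 2) :=
    aux_int hK hs (((hwc.pow 2).mul hlap).pow 2) fun x hx => by simp [hs0 _ x hx]
  have iE : Integrable (fun x => |v x| * (w x * ‖gradient v x‖)) :=
    aux_int hK hs (hvc.abs.mul (hwc.mul hnmc1)) fun x hx => by simp [hv0 x hx]
  have hid : (∫ x in Ω, (w x) ^ 2 * ‖gradient v x‖ ^ 2) =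
        -2 * (∫ x in Ω, w x * v x * ⟪gradient w x, gradient v x⟫) -
          ∫ x in Ω, (w x) ^ 2 * v x * (∑ i, secondPartial N v i i x) := by
    have hsum : ∫ x in Ω, ∑ i, (2 * (w x * v x * (gradient w x i * gradient v x i))
      + w x ^ 2 * (gradient v x i) ^ 2 + w x ^ 2 * v x * secondPartial N v i i x) = 0 := by
      rw [integral_finsetSum]
      · exact Finset.sum_eq_zero fun i _ => aux_div hΩ hw hv hc hs i
      · intro i _
        apply Integrable.integrableOn
        refine aux_int hK hs ?_ fun x hx => by simp [hv0 x hx, hg0 x hx]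
        exact ((continuousOn_const.mul ((hwc.mul hvc).mul ((hgw i).mul (hgv i)))).add
          ((hwc.pow 2).mul ((hgv i).pow 2))).add (((hwc.pow 2).mul hvc).mul (hsp i))
    have heq : ∀ x, ∑ i, (2 * (w x * v x * (gradient w x i * gradient v x i))
      + w x ^ 2 * (gradient v x i) ^ 2 + w x ^ 2 * v x * secondPartial N v i i x) =
      2 * (w x * v x * (⟪gradient w x, gradient v x⟫ : ℝ)) + w x ^ 2 * ‖gradient v x‖ ^ 2
        + w x ^ 2 * v x * (∑ i, secondPartial N v i i x) := by
      intro x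
      rw [hin, hnm]
      simp only [Finset.sum_add_distrib, Finset.mul_sum]
    simp only [heq] at hsum
    have hab : Integrable (fun x => 2 * (w x * v x * (⟪gradient w x, gradient v x⟫ : ℝ))
        + w x ^ 2 * ‖gradient v x‖ ^ 2) := (iB.const_mul 2).add iA
    rw [integral_add hab.integrableOn iC.integrableOn,
      integral_add (iB.const_mul 2).integrableOn iA.integrableOn, integral_const_mul] at hsum
    linarith
  refine ⟨hid, ?_⟩
  rcases Ω.eq_empty_or_nonempty with hE | ⟨x0, hx0⟩
  · simp [hE]
  have hL : 0 ≤ L := (norm_nonneg _).trans (hwL x0 hx0)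
  apply aux_quad (Real.sqrt_nonneg _) (Real.sqrt_nonneg _) hL
  have hA0 : 0 ≤ ∫ x in Ω, (w x) ^ 2 * ‖gradient v x‖ ^ 2 := integral_nonneg fun x => by positivity
  rw [Real.sq_sqrt hA0]
  have c1 := aux_cs (μ := volume.restrict Ω) (f := fun x => |v x|)
    (g := fun x => w x * ‖gradient v x‖) (by simpa using iV.restrict (s := Ω))
    (by simpa [mul_pow] using iA.restrict (s := Ω)) iE.integrableOn
  have c2 := aux_cs (μ := volume.restrict Ω) (f := v)
    (g := fun x => w x ^ 2 * (∑ i, secondPartial N v i i x)) iV.integrableOn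
    iD.integrableOn (by
      have := iC.integrableOn (s := Ω)
      refine Integrable.congr this (Filter.Eventually.of_forall fun x => ?_)
      simp only; ring)
  simp only [sq_abs, mul_pow (w _) ‖_‖] at c1
  have e2 : (∫ x in Ω, v x * (w x ^ 2 * (∑ i, secondPartial N v i i x))) =
      ∫ x in Ω, (w x) ^ 2 * v x * (∑ i, secondPartial N v i i x) := by
    congr 1; ext x; ring
  rw [e2] at c2
  have b1 : |∫ x in Ω, w x * v x * (⟪gradient w x, gradient v x⟫ : ℝ)| ≤
      L * ∫ x in Ω, |v x| * (w x * ‖gradient v x‖) := by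
    rw [← integral_const_mul]
    refine abs_integral_le_integral_abs.trans ?_
    refine setIntegral_mono_on iB.abs.integrableOn (iE.const_mul L).integrableOn
      hΩ.measurableSet ?_
    intro x hx
    rw [abs_mul, abs_mul, abs_of_nonneg (hw0 x hx)]
    have h1 : |(⟪gradient w x, gradient v x⟫ : ℝ)| ≤ L * ‖gradient v x‖ :=
      (abs_real_inner_le_norm _ _).trans
        (mul_le_mul_of_nonneg_right (hwL x hx) (norm_nonneg _))
    calc w x * |v x| * |(⟪gradient w x, gradient v x⟫ : ℝ)|
        ≤ w x * |v x| * (L * ‖gradient v x‖) :=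
          mul_le_mul_of_nonneg_left h1 (mul_nonneg (hw0 x hx) (abs_nonneg _))
      _ = _ := by ring
  have b2 := mul_le_mul_of_nonneg_left ((le_abs_self _).trans c1) hL
  have b3 := (neg_le_abs _).trans b1
  have b4 := (neg_le_abs _).trans c2
  linarith
end

section
/- Let Ω ⊆ ℝ^N be a bounded open set with smooth boundary and outward unit normal n. Let v ∈ C²(Ω̄) with v = 0 on ∂Ω, and let h ∈ C¹(Ω̄; ℝ^N). Then the Rellich identity holds: ∫_{∂Ω} (h·n)·|∂v/∂n|² dσ = ∫_Ω [ 2(h·∇v)·Δv + 2 Σ_k (∂h/∂x_k · ∇v)·(∂v/∂x_k) - (div h)·|∇v|² ] dx. -/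
open RealInnerProductSpace

/-- Divergence of a vector field on `ℝ^N`: `div F = Σ_i ⟪∂F/∂x_i, e_i⟫`. -/
noncomputable def vdiv (N : ℕ) (F : EuclideanSpace ℝ (Fin N) → EuclideanSpace ℝ (Fin N))
    (x : EuclideanSpace ℝ (Fin N)) : ℝ :=
  ∑ i, (⟪fderiv ℝ F x (EuclideanSpace.single i 1), EuclideanSpace.single i 1⟫ : ℝ)

/-- Laplacian `Δv = Σ_i ∂²v/∂x_i²` on `ℝ^N`. -/
noncomputable def lap (N : ℕ) (v : EuclideanSpace ℝ (Fin N) → ℝ)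
    (x : EuclideanSpace ℝ (Fin N)) : ℝ :=
  ∑ i, fderiv ℝ (fun y => fderiv ℝ v y (EuclideanSpace.single i 1)) x
    (EuclideanSpace.single i 1)


open MeasureTheory

theorem sum_coord (N : ℕ) (a : EuclideanSpace ℝ (Fin N)) :
    ∑ i, a i • (EuclideanSpace.single i (1:ℝ) : EuclideanSpace ℝ (Fin N)) = a := by
  ext j
  simp [Pi.single_apply]

theorem inner_single_r {N : ℕ} (a : EuclideanSpace ℝ (Fin N)) (i : Fin N) :
    (⟪a, EuclideanSpace.single i (1:ℝ)⟫ : ℝ) = a i := by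
  rw [EuclideanSpace.inner_single_right]; simp

theorem inner_single_l {N : ℕ} (a : EuclideanSpace ℝ (Fin N)) (i : Fin N) :
    (⟪EuclideanSpace.single i (1:ℝ), a⟫ : ℝ) = a i := by
  rw [EuclideanSpace.inner_single_left]; simp

theorem inner_grad {N : ℕ} (v : EuclideanSpace ℝ (Fin N) → ℝ) (x a : EuclideanSpace ℝ (Fin N)) :
    (⟪gradient v x, a⟫ : ℝ) = fderiv ℝ v x a := by
  rw [← toDual_gradient]; simp

theorem contDiff_grad {N : ℕ} {v : EuclideanSpace ℝ (Fin N) → ℝ} (hv : ContDiff ℝ 2 v) :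
    ContDiff ℝ 1 (gradient v) := by
  have h1 : ContDiff ℝ 1 (fderiv ℝ v) := hv.fderiv_right (by norm_num)
  exact ((InnerProductSpace.toDual ℝ (EuclideanSpace ℝ (Fin N))).symm.toContinuousLinearEquiv.contDiff.comp h1)

theorem fderiv_inner_grad {N : ℕ} {v : EuclideanSpace ℝ (Fin N) → ℝ} (hv : ContDiff ℝ 2 v)
    (x a b : EuclideanSpace ℝ (Fin N)) :
    (⟪fderiv ℝ (gradient v) x a, b⟫ : ℝ) = fderiv ℝ (fun y => fderiv ℝ v y b) x a := by
  have hg : DifferentiableAt ℝ (gradient v) x := (contDiff_grad hv).differentiable (by norm_num) x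
  have : (fun y => fderiv ℝ v y b) = fun y => (⟪gradient v y, b⟫ : ℝ) := by
    funext y; rw [inner_grad]
  rw [this, fderiv_inner_apply ℝ hg (by fun_prop)]
  simp

theorem symm2 {N : ℕ} {v : EuclideanSpace ℝ (Fin N) → ℝ} (hv : ContDiff ℝ 2 v)
    (x a b : EuclideanSpace ℝ (Fin N)) :
    fderiv ℝ (fun y => fderiv ℝ v y b) x a = fderiv ℝ (fun y => fderiv ℝ v y a) x b := by
  have h1 : ContDiff ℝ 1 (fderiv ℝ v) := hv.fderiv_right (by norm_num)
  have h2 : DifferentiableAt ℝ (fderiv ℝ v) x := h1.differentiable (by norm_num) x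
  have hs : IsSymmSndFDerivAt ℝ v x := hv.contDiffAt.isSymmSndFDerivAt (by simp)
  rw [fderiv_clm_apply h2 (by fun_prop), fderiv_clm_apply h2 (by fun_prop)]
  simpa using hs a b

theorem vdiv_smul {N : ℕ} {f : EuclideanSpace ℝ (Fin N) → ℝ}
    {G : EuclideanSpace ℝ (Fin N) → EuclideanSpace ℝ (Fin N)} {x : EuclideanSpace ℝ (Fin N)}
    (hf : DifferentiableAt ℝ f x) (hG : DifferentiableAt ℝ G x) :
    vdiv N (fun y => f y • G y) x = fderiv ℝ f x (G x) + f x * vdiv N G x := by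
  unfold vdiv
  rw [fderiv_fun_smul hf hG]
  have h1 : fderiv ℝ f x (G x) = ∑ i, G x i * fderiv ℝ f x (EuclideanSpace.single i 1) := by
    conv_lhs => rw [← sum_coord N (G x)]
    simp
  rw [h1, Finset.mul_sum, ← Finset.sum_add_distrib]
  refine Finset.sum_congr rfl fun i _ => ?_
  simp [inner_add_left, inner_smul_left, inner_single_r]
  ring

theorem vdiv_add {N : ℕ} {F G : EuclideanSpace ℝ (Fin N) → EuclideanSpace ℝ (Fin N)}
    {x : EuclideanSpace ℝ (Fin N)}
    (hf : DifferentiableAt ℝ F x) (hG : DifferentiableAt ℝ G x) :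
    vdiv N (fun y => F y + G y) x = vdiv N F x + vdiv N G x := by
  unfold vdiv
  rw [fderiv_fun_add hf hG, ← Finset.sum_add_distrib]
  simp [inner_add_left]

theorem vdiv_sub {N : ℕ} {F G : EuclideanSpace ℝ (Fin N) → EuclideanSpace ℝ (Fin N)}
    {x : EuclideanSpace ℝ (Fin N)}
    (hf : DifferentiableAt ℝ F x) (hG : DifferentiableAt ℝ G x) :
    vdiv N (fun y => F y - G y) x = vdiv N F x - vdiv N G x := by
  unfold vdiv
  rw [fderiv_fun_sub hf hG, ← Finset.sum_sub_distrib]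
  simp [inner_sub_left]

theorem vdiv_const {N : ℕ} (b x : EuclideanSpace ℝ (Fin N)) :
    vdiv N (fun _ => b) x = 0 := by
  simp [vdiv]

theorem vdiv_id {N : ℕ} (x : EuclideanSpace ℝ (Fin N)) :
    vdiv N (fun y => y) x = N := by
  simp [vdiv]

theorem vdiv_smul_const {N : ℕ} {f : EuclideanSpace ℝ (Fin N) → ℝ}
    {x : EuclideanSpace ℝ (Fin N)} (b : EuclideanSpace ℝ (Fin N))
    (hf : DifferentiableAt ℝ f x) :
    vdiv N (fun y => f y • b) x = fderiv ℝ f x b := by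
  rw [vdiv_smul hf (by fun_prop), vdiv_const]; simp

theorem vdiv_integrable {N : ℕ} {Ω : Set (EuclideanSpace ℝ (Fin N))}
    (hb : Bornology.IsBounded Ω) {F : EuclideanSpace ℝ (Fin N) → EuclideanSpace ℝ (Fin N)}
    (hF : ContDiff ℝ 1 F) : IntegrableOn (vdiv N F) Ω := by
  have hc : Continuous (vdiv N F) := by
    have : Continuous (fderiv ℝ F) := hF.continuous_fderiv (by norm_num)
    unfold vdiv
    fun_prop
  exact (hc.continuousOn.integrableOn_compact hb.isCompact_closure).mono_set subset_closure

theorem vdiv_main {N : ℕ} {v : EuclideanSpace ℝ (Fin N) → ℝ} (hv : ContDiff ℝ 2 v)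
    {h : EuclideanSpace ℝ (Fin N) → EuclideanSpace ℝ (Fin N)} (hh : ContDiff ℝ 1 h)
    (x : EuclideanSpace ℝ (Fin N)) :
    vdiv N (fun y => (2 * (⟪h y, gradient v y⟫ : ℝ)) • gradient v y
        - (⟪gradient v y, gradient v y⟫ : ℝ) • h y) x =
      2 * (⟪h x, gradient v x⟫ : ℝ) * lap N v x +
          2 * ∑ k, (⟪fderiv ℝ h x (EuclideanSpace.single k 1), gradient v x⟫ : ℝ) *
            fderiv ℝ v x (EuclideanSpace.single k 1) -
          vdiv N h x * ‖gradient v x‖ ^ 2 := by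
  have hg : DifferentiableAt ℝ (gradient v) x := (contDiff_grad hv).differentiable (by norm_num) x
  have hd : DifferentiableAt ℝ h x := hh.differentiable (by norm_num) x
  have hi : DifferentiableAt ℝ (fun y => (⟪h y, gradient v y⟫ : ℝ)) x := hd.inner ℝ hg
  have hi2 : DifferentiableAt ℝ (fun y => (⟪gradient v y, gradient v y⟫ : ℝ)) x := hg.inner ℝ hg
  rw [vdiv_sub (by fun_prop) (by fun_prop), vdiv_smul (by fun_prop) hg, vdiv_smul hi2 hd,
    fderiv_const_mul hi, smul_apply,
    fderiv_inner_apply ℝ hd hg, fderiv_inner_apply ℝ hg hg]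
  have h1 : vdiv N (gradient v) x = lap N v x := by
    unfold vdiv lap
    exact Finset.sum_congr rfl fun i _ => fderiv_inner_grad hv _ _ _
  have h2 : ∑ k, (⟪fderiv ℝ h x (EuclideanSpace.single k 1), gradient v x⟫ : ℝ) *
            fderiv ℝ v x (EuclideanSpace.single k 1) =
      (⟪fderiv ℝ h x (gradient v x), gradient v x⟫ : ℝ) := by
    have h3 : fderiv ℝ h x (gradient v x) =
        ∑ k, gradient v x k • fderiv ℝ h x (EuclideanSpace.single k 1) := by
      conv_lhs => rw [← sum_coord N (gradient v x)]
      simp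
    rw [h3, sum_inner]
    refine Finset.sum_congr rfl fun k _ => ?_
    rw [← inner_grad, inner_smul_left, inner_single_r, mul_comm]
    rfl
  have h4 : (⟪h x, fderiv ℝ (gradient v) x (gradient v x)⟫ : ℝ) =
      ⟪gradient v x, fderiv ℝ (gradient v) x (h x)⟫ := by
    rw [real_inner_comm, fderiv_inner_grad hv, symm2 hv, ← fderiv_inner_grad hv, real_inner_comm]
  rw [h1, h2, h4, real_inner_comm (gradient v x) (fderiv ℝ (gradient v) x (h x)),
    real_inner_self_eq_norm_sq]
  simp only [smul_eq_mul]
  ring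

theorem vdiv_tang {N : ℕ} {v φ : EuclideanSpace ℝ (Fin N) → ℝ} (hv : ContDiff ℝ 2 v)
    (hφ : ContDiff ℝ 2 φ) (a b x : EuclideanSpace ℝ (Fin N)) :
    vdiv N (fun y => (φ y * fderiv ℝ v y a) • b - (φ y * fderiv ℝ v y b) • a) x =
    vdiv N (fun y => v y • (fderiv ℝ φ y b • a - fderiv ℝ φ y a • b)) x := by
  have h1 : ContDiff ℝ 1 (fderiv ℝ v) := hv.fderiv_right (by norm_num)
  have h2 : DifferentiableAt ℝ (fderiv ℝ v) x := h1.differentiable (by norm_num) x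
  have h3 : ContDiff ℝ 1 (fderiv ℝ φ) := hφ.fderiv_right (by norm_num)
  have h4 : DifferentiableAt ℝ (fderiv ℝ φ) x := h3.differentiable (by norm_num) x
  have h5 : DifferentiableAt ℝ v x := hv.differentiable (by norm_num) x
  have h6 : DifferentiableAt ℝ φ x := hφ.differentiable (by norm_num) x
  rw [vdiv_sub (by fun_prop) (by fun_prop), vdiv_smul_const _ (by fun_prop),
    vdiv_smul_const _ (by fun_prop), vdiv_smul h5 (by fun_prop),
    vdiv_sub (by fun_prop) (by fun_prop), vdiv_smul_const _ (by fun_prop),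
    vdiv_smul_const _ (by fun_prop), fderiv_fun_mul (by fun_prop) (by fun_prop),
    fderiv_fun_mul (by fun_prop) (by fun_prop), symm2 hφ x a b]
  simp only [add_apply, smul_apply, smul_eq_mul,
    map_sub, map_smul, symm2 hv x a b]
  ring

theorem frontier_empty_or {N : ℕ} {Ω : Set (EuclideanSpace ℝ (Fin N))} (hΩ : IsOpen Ω)
    (hb : Bornology.IsBounded Ω) (h : (∫ x in Ω, vdiv N (fun y => y) x) = 0) :
    frontier Ω = ∅ := by
  simp only [vdiv_id] at h
  rw [setIntegral_const, smul_eq_mul, mul_eq_zero] at h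
  rcases h with h | h
  · have : volume Ω = 0 := by
      rw [Measure.real, ENNReal.toReal_eq_zero_iff] at h
      exact h.resolve_right hb.measure_lt_top.ne
    rw [hΩ.measure_eq_zero_iff (μ := volume)] at this
    simp [this]
  · have : N = 0 := by exact_mod_cast h
    subst this
    exact (isClopen_discrete Ω).frontier_eq

theorem flux_integrable {N : ℕ} {Ω : Set (EuclideanSpace ℝ (Fin N))} (hΩ : IsOpen Ω)
    (hb : Bornology.IsBounded Ω)
    (σ : MeasureTheory.Measure (EuclideanSpace ℝ (Fin N)))
    (n : EuclideanSpace ℝ (Fin N) → EuclideanSpace ℝ (Fin N))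
    (hdiv : ∀ F : EuclideanSpace ℝ (Fin N) → EuclideanSpace ℝ (Fin N), ContDiff ℝ 1 F →
      (∫ x in frontier Ω, (⟪F x, n x⟫ : ℝ) ∂σ) = ∫ x in Ω, vdiv N F x)
    {F : EuclideanSpace ℝ (Fin N) → EuclideanSpace ℝ (Fin N)} (hF : ContDiff ℝ 1 F) :
    Integrable (fun x => (⟪F x, n x⟫ : ℝ)) (σ.restrict (frontier Ω)) := by
  by_contra hc
  suffices h0 : (∫ x in Ω, vdiv N (fun y => y) x) = 0 by
    apply hc
    rw [frontier_empty_or hΩ hb h0]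
    simp
  have hid : ContDiff ℝ 1 (fun y : EuclideanSpace ℝ (Fin N) => y) := contDiff_id
  have hFd := hF.differentiable (by norm_num)
  have key : ∀ G : EuclideanSpace ℝ (Fin N) → EuclideanSpace ℝ (Fin N), ContDiff ℝ 1 G →
      ¬ Integrable (fun x => (⟪G x, n x⟫ : ℝ)) (σ.restrict (frontier Ω)) →
      ∫ x in Ω, vdiv N G x = 0 := by
    intro G hG hn
    rw [← hdiv G hG, integral_undef hn]
  have hFG : ContDiff ℝ 1 (fun y => F y + y) := hF.add hid
  have e1 : ∫ x in Ω, vdiv N (fun y => F y + y) x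
      = (∫ x in Ω, vdiv N F x) + ∫ x in Ω, vdiv N (fun y => y) x := by
    rw [← integral_add (vdiv_integrable hb hF) (vdiv_integrable hb hid)]
    congr 1; funext x; exact vdiv_add (hFd x) (by fun_prop)
  by_cases h1 : Integrable (fun x => (⟪F x + x, n x⟫ : ℝ)) (σ.restrict (frontier Ω))
  · have h2 : ¬ Integrable (fun x => (⟪(F x + x) + x, n x⟫ : ℝ)) (σ.restrict (frontier Ω)) := by
      intro h2
      apply hc
      refine ((h1.const_mul 2).sub h2).congr (Filter.Eventually.of_forall fun x => ?_)
      simp [inner_add_left]; ring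
    have e2 : ∫ x in Ω, vdiv N (fun y => (F y + y) + y) x
      = (∫ x in Ω, vdiv N (fun y => F y + y) x) + ∫ x in Ω, vdiv N (fun y => y) x := by
      rw [← integral_add (vdiv_integrable hb hFG) (vdiv_integrable hb hid)]
      congr 1; funext x
      exact vdiv_add (hFG.differentiable (by norm_num) x) (by fun_prop)
    have := key _ (hFG.add hid) h2
    have := key _ hF hc
    linarith
  · have := key _ hFG h1
    have := key _ hF hc
    linarith

/-- Rellich identity.  Let `Ω ⊆ ℝ^N` be a bounded open set whose boundary
`∂Ω = frontier Ω` carries a surface measure `σ` and an outward unit normal field `n`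
satisfying the divergence theorem.  Then for every `C²` function `v` vanishing on `∂Ω`
and every `C¹` vector field `h`:
`∫_{∂Ω} (h·n)|∂v/∂n|² dσ
  = ∫_Ω [2(h·∇v)Δv + 2Σ_k (∂h/∂x_k·∇v)(∂v/∂x_k) - (div h)|∇v|²]`. -/
theorem stmt18 (N : ℕ) (Ω : Set (EuclideanSpace ℝ (Fin N))) (hΩ : IsOpen Ω)
    (hb : Bornology.IsBounded Ω)
    (σ : MeasureTheory.Measure (EuclideanSpace ℝ (Fin N)))
    (n : EuclideanSpace ℝ (Fin N) → EuclideanSpace ℝ (Fin N))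
    (hn : ∀ x ∈ frontier Ω, ‖n x‖ = 1)
    (hdiv : ∀ F : EuclideanSpace ℝ (Fin N) → EuclideanSpace ℝ (Fin N), ContDiff ℝ 1 F →
      (∫ x in frontier Ω, (⟪F x, n x⟫ : ℝ) ∂σ) = ∫ x in Ω, vdiv N F x)
    (v : EuclideanSpace ℝ (Fin N) → ℝ) (hv : ContDiff ℝ 2 v)
    (hv0 : ∀ x ∈ frontier Ω, v x = 0)
    (h : EuclideanSpace ℝ (Fin N) → EuclideanSpace ℝ (Fin N)) (hh : ContDiff ℝ 1 h) :
    (∫ x in frontier Ω, (⟪h x, n x⟫ : ℝ) * (⟪gradient v x, n x⟫ : ℝ) ^ 2 ∂σ) =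
      ∫ x in Ω,
        (2 * (⟪h x, gradient v x⟫ : ℝ) * lap N v x +
          2 * ∑ k, (⟪fderiv ℝ h x (EuclideanSpace.single k 1), gradient v x⟫ : ℝ) *
            fderiv ℝ v x (EuclideanSpace.single k 1) -
          vdiv N h x * ‖gradient v x‖ ^ 2) := by
  have hfl := fun F hF => flux_integrable hΩ hb σ n hdiv (F := F) hF
  have hgc := contDiff_grad hv
  have hae : ∀ a b : EuclideanSpace ℝ (Fin N), ∀ᵐ x ∂(σ.restrict (frontier Ω)),
      (⟪(fderiv ℝ v x a) • b - (fderiv ℝ v x b) • a, n x⟫ : ℝ) = 0 := by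
    intro a b
    have h1 : ContDiff ℝ 1 (fderiv ℝ v) := hv.fderiv_right (by norm_num)
    apply ae_eq_zero_of_integral_contDiff_smul_eq_zero
    · exact (hfl _ (by fun_prop)).locallyIntegrable
    · intro φ hφ _
      have hφ2 : ContDiff ℝ 2 φ := contDiff_infty.1 hφ 2
      have hφ1 : ContDiff ℝ 1 φ := hφ2.of_le (by norm_num)
      have hv1 : ContDiff ℝ 1 v := hv.of_le (by norm_num)
      have h3 : ContDiff ℝ 1 (fderiv ℝ φ) := hφ2.fderiv_right (by norm_num)
      have e1 := hdiv (fun y => (φ y * fderiv ℝ v y a) • b - (φ y * fderiv ℝ v y b) • a)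
        (by fun_prop)
      have e2 := hdiv (fun y => v y • (fderiv ℝ φ y b • a - fderiv ℝ φ y a • b)) (by fun_prop)
      simp only [vdiv_tang hv hφ2 a b] at e1
      rw [← e2] at e1
      have e3 : ∫ x in frontier Ω, (⟪v x • (fderiv ℝ φ x b • a - fderiv ℝ φ x a • b), n x⟫ : ℝ) ∂σ
          = 0 := by
        rw [setIntegral_congr_fun (g := fun _ => 0) isClosed_frontier.measurableSet]
        · simp
        · intro x hx; simp [hv0 x hx]
      rw [e3] at e1
      rw [← e1]
      congr 1; funext x
      simp only [mul_smul, ← smul_sub, inner_smul_left, smul_eq_mul]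
      simp
  have hae2 : ∀ᵐ x ∂(σ.restrict (frontier Ω)), ∀ i j : Fin N,
      gradient v x i * n x j = gradient v x j * n x i := by
    rw [ae_all_iff]; intro i
    rw [ae_all_iff]; intro j
    filter_upwards [hae (EuclideanSpace.single i 1) (EuclideanSpace.single j 1)] with x hx
    simp only [← inner_grad, inner_sub_left, inner_smul_left, inner_single_r,
      inner_single_l, conj_trivial] at hx
    linarith
  have hF : ContDiff ℝ 1 (fun y => (2 * (⟪h y, gradient v y⟫ : ℝ)) • gradient v y
        - (⟪gradient v y, gradient v y⟫ : ℝ) • h y) := by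
    have := hh.inner ℝ hgc
    have := hgc.inner ℝ hgc
    fun_prop
  have e := hdiv _ hF
  simp only [vdiv_main hv hh] at e
  rw [← e]
  apply integral_congr_ae
  filter_upwards [hae2, ae_restrict_mem isClosed_frontier.measurableSet] with x hx hxf
  have hn1 : (⟪n x, n x⟫ : ℝ) = 1 := by rw [real_inner_self_eq_norm_sq, hn x hxf]; norm_num
  have hg : gradient v x = (⟪gradient v x, n x⟫ : ℝ) • n x := by
    ext i
    have : gradient v x i = ∑ j, gradient v x i * n x j * n x j := by
      rw [PiLp.inner_apply] at hn1
      simp only [mul_assoc]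
      rw [← Finset.mul_sum]
      simp at hn1
      simp [← pow_two, hn1]
    rw [this]
    simp only [hx i]
    rw [PiLp.smul_apply, PiLp.inner_apply, smul_eq_mul, Finset.sum_mul]
    refine Finset.sum_congr rfl fun j _ => ?_
    simp
    ring
  set c : ℝ := ⟪gradient v x, n x⟫ with hc
  rw [hg]
  simp only [inner_sub_left, inner_smul_left, inner_smul_right, hn1]
  simp
  ring
end
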